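/- arXiv:1904.08857 — 2 statements merged into one kernel-verified Lean document; each statement's English description precedes it below -/
import Mathlib

section
/- Let n ≥ 2 and let σ be a cycle of length n on {1,…,n} (identified with ℤ/nℤ). Then the cyclic descent number is invariant under conjugation by the rotation: des̄(Tσ) = des̄(σ), where Tσ := τ∘σ∘τ^{-1} and τ(a) = a+1 mod n. -/
open Finset Polynomial

/-- The representative in `{1,…,n}` of a residue class `a : ZMod n`. -/
def zrep (n : ℕ) (a : ZMod n) : ℕ := if a.val = 0 then n else a.val

/-- The major index of a permutation of `{1,…,n}` (identified with `ZMod n`). -/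
def maj (n : ℕ) (σ : Equiv.Perm (ZMod n)) : ℕ :=
  ∑ i ∈ Finset.Icc 1 (n - 1),
    if zrep n (σ ((i : ZMod n) + 1)) < zrep n (σ (i : ZMod n)) then i else 0

/-- The cyclic major index. -/
def majbar (n : ℕ) (σ : Equiv.Perm (ZMod n)) : ℕ :=
  ∑ i ∈ Finset.Icc 1 n,
    if zrep n (σ ((i : ZMod n) + 1)) < zrep n (σ (i : ZMod n)) then i else 0

/-- The cyclic descent number. -/
def desbar (n : ℕ) (σ : Equiv.Perm (ZMod n)) : ℕ :=
  ((Finset.Icc 1 n).filter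
    (fun i : ℕ => zrep n (σ (((i : ℕ) : ZMod n) + 1)) < zrep n (σ ((i : ℕ) : ZMod n)))).card

/-- Conjugation by the rotation `a ↦ a + 1`. -/
def Tmap (n : ℕ) (σ : Equiv.Perm (ZMod n)) : Equiv.Perm (ZMod n) :=
  Equiv.addRight (1 : ZMod n) * σ * (Equiv.addRight (1 : ZMod n))⁻¹
theorem zrep_add_one (n : ℕ) [NeZero n] (a : ZMod n) : zrep n (a + 1) = a.val + 1 := by
  have hlt := a.val_lt
  have hval : (a + 1).val = (a.val + 1) % n := by
    rw [← ZMod.val_natCast n (a.val + 1)]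
    simp
  unfold zrep
  rw [hval]
  rcases Nat.lt_or_ge (a.val + 1) n with h | h
  · rw [Nat.mod_eq_of_lt h]
    simp
  · have hn : a.val + 1 = n := by omega
    simp [hn]

/-- The cyclic descent number as a sum over `ZMod n`. -/
theorem desbar_eq_sum (n : ℕ) [NeZero n] (σ : Equiv.Perm (ZMod n)) :
    desbar n σ = ∑ i : ZMod n, if zrep n (σ (i + 1)) < zrep n (σ i) then 1 else 0 := by
  unfold desbar
  rw [Finset.card_filter]
  refine Finset.sum_bij' (fun i _ => (i : ZMod n)) (fun a _ => zrep n a) ?_ ?_ ?_ ?_ ?_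
  · simp
  · intro a _
    have := a.val_lt
    rw [Finset.mem_Icc, zrep]
    split_ifs <;> omega
  · intro i hi
    rw [Finset.mem_Icc] at hi
    simp only [zrep, ZMod.val_natCast]
    rcases hi.2.lt_or_eq with h | h
    · rw [Nat.mod_eq_of_lt h, if_neg (by omega)]
    · simp [h]
  · intro a _
    unfold zrep
    split_ifs with h
    · rw [ZMod.val_eq_zero] at h
      simp [h]
    · simp
  · simp

/-- Shifting two distinct classes by one changes their comparison only at the class `0`. -/
theorem zrep_lt_shift (n : ℕ) [NeZero n] {a b : ZMod n} (hab : a ≠ b) :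
    ((if zrep n (b + 1) < zrep n (a + 1) then 1 else 0) + if a = 0 then 1 else 0 : ℕ) =
      (if zrep n b < zrep n a then 1 else 0) + if b = 0 then 1 else 0 := by
  have ha := a.val_lt
  have hb := b.val_lt
  have hne : a.val ≠ b.val := fun h => hab (ZMod.val_injective n h)
  rw [zrep_add_one, zrep_add_one]
  simp only [← ZMod.val_eq_zero, zrep]
  split_ifs <;> omega

theorem desbar_Tmap_eq_sum (n : ℕ) [NeZero n] (σ : Equiv.Perm (ZMod n)) :
    desbar n (Tmap n σ) =
      ∑ i : ZMod n, if zrep n (σ (i + 1) + 1) < zrep n (σ i + 1) then 1 else 0 := by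
  rw [desbar_eq_sum, ← Equiv.sum_comp (Equiv.addRight (1 : ZMod n))]
  simp [Tmap]

theorem sum_ite_perm_eq_zero (n : ℕ) [NeZero n] (σ : Equiv.Perm (ZMod n)) :
    (∑ i : ZMod n, if σ i = 0 then 1 else 0 : ℕ) = 1 := by
  rw [Equiv.sum_comp σ (fun a => if a = 0 then 1 else 0)]
  simp

/-- `des̄(Tσ) = des̄(σ)` for an n-cycle σ. -/
theorem desbar_Tmap (n : ℕ) [NeZero n] (hn : 2 ≤ n) (σ : Equiv.Perm (ZMod n))
    (hc : σ.IsCycle) (hs : σ.support.card = n) :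
    desbar n (Tmap n σ) = desbar n σ := by
  have : Fact (1 < n) := ⟨hn⟩
  have hshift : ∀ i : ZMod n, σ i ≠ σ (i + 1) := fun i h => by
    simpa using σ.injective h
  have key := Finset.sum_congr (s₁ := (Finset.univ : Finset (ZMod n))) rfl
    fun i _ => zrep_lt_shift n (hshift i)
  rw [Finset.sum_add_distrib, Finset.sum_add_distrib, sum_ite_perm_eq_zero,
    ← desbar_Tmap_eq_sum, ← desbar_eq_sum,
    show (∑ i : ZMod n, if σ (i + 1) = 0 then 1 else 0 : ℕ) = 1 from
      sum_ite_perm_eq_zero n (σ * Equiv.addRight (1 : ZMod n))] at key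
  exact Nat.add_right_cancel key
end

section
/- Let n ≥ 2 and let σ be a cycle of length n on {1,…,n} (identified with ℤ/nℤ). Then des̄(σ) = 1 if and only if σ = λ_r for some r with 1 ≤ r ≤ n and gcd(r,n) = 1, where λ_r is the permutation a ↦ a + r of ℤ/nℤ. -/
open Finset Polynomial

theorem zrep_cast (n : ℕ) [NeZero n] (a : ZMod n) : ((zrep n a : ℕ) : ZMod n) = a := by
  unfold zrep
  split_ifs with h
  · rw [ZMod.natCast_self, (ZMod.val_eq_zero a).1 h]
  · exact ZMod.natCast_zmod_val a

theorem one_le_zrep (n : ℕ) [NeZero n] (a : ZMod n) : 1 ≤ zrep n a := by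
  unfold zrep
  split_ifs with h
  · exact NeZero.one_le
  · omega

theorem zrep_le (n : ℕ) [NeZero n] (a : ZMod n) : zrep n a ≤ n := by
  unfold zrep
  split_ifs with h
  · exact le_rfl
  · exact (ZMod.val_lt a).le

theorem zrep_natCast (n : ℕ) [NeZero n] {i : ℕ} (h₁ : 1 ≤ i) (h₂ : i ≤ n) :
    zrep n (i : ZMod n) = i := by
  unfold zrep
  rw [ZMod.val_natCast]
  rcases h₂.eq_or_lt with rfl | h
  · simp
  · rw [Nat.mod_eq_of_lt h, if_neg (by omega)]

theorem val_sub_eq_zrep_sub (n : ℕ) [NeZero n] (x y : ZMod n) :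
    ((x - y).val : ℤ) = zrep n x - zrep n y + if zrep n x < zrep n y then (n : ℤ) else 0 := by
  have hx := one_le_zrep n x
  have hy := one_le_zrep n y
  have hx' := zrep_le n x
  have hy' := zrep_le n y
  have hcast : ((zrep n x - zrep n y + if zrep n x < zrep n y then (n : ℤ) else 0 : ℤ) : ZMod n)
      = x - y := by
    split_ifs <;> simp [zrep_cast]
  rw [← hcast, ZMod.val_intCast]
  apply Int.emod_eq_of_lt <;> split_ifs <;> omega

theorem desbar_eq_card_univ_filter (n : ℕ) [NeZero n] (σ : Equiv.Perm (ZMod n)) :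
    desbar n σ = (univ.filter fun a : ZMod n => zrep n (σ (a + 1)) < zrep n (σ a)).card := by
  refine Finset.card_nbij' (fun i : ℕ => (i : ZMod n)) (zrep n) ?_ ?_ ?_ ?_
  · intro i hi
    simpa using (Finset.mem_filter.1 hi).2
  · intro a ha
    simpa [zrep_cast, one_le_zrep, zrep_le] using ha
  · intro i hi
    have h := Finset.mem_Icc.1 (Finset.mem_filter.1 hi).1
    exact zrep_natCast n h.1 h.2
  · intro a _
    exact zrep_cast n a

/-- The cyclic increments of `σ`, taken in `{0,…,n-1}`, add up to `n` times the cyclic descent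
number. -/
theorem sum_val_sub_eq_mul_desbar (n : ℕ) [NeZero n] (σ : Equiv.Perm (ZMod n)) :
    ∑ a, (σ (a + 1) - σ a).val = n * desbar n σ := by
  have hshift : ∑ a, (zrep n (σ (a + 1)) : ℤ) = ∑ a, (zrep n (σ a) : ℤ) :=
    Equiv.sum_comp (Equiv.addRight (1 : ZMod n)) fun a => (zrep n (σ a) : ℤ)
  zify
  simp_rw [val_sub_eq_zrep_sub, Finset.sum_add_distrib, Finset.sum_sub_distrib, hshift,
    desbar_eq_card_univ_filter, ← Finset.sum_filter]
  simp [mul_comm]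

theorem desbar_eq_one_iff_map_add_one (n : ℕ) [NeZero n] (hn : 2 ≤ n)
    (σ : Equiv.Perm (ZMod n)) : desbar n σ = 1 ↔ ∀ a, σ (a + 1) = σ a + 1 := by
  have : Fact (1 < n) := ⟨hn⟩
  have hsum := sum_val_sub_eq_mul_desbar n σ
  have hcard : ∑ _a : ZMod n, 1 = n := by simp [ZMod.card]
  constructor
  · intro h a
    have hpos : ∀ a ∈ univ, 1 ≤ (σ (a + 1) - σ a).val := by
      intro a _
      rw [Nat.one_le_iff_ne_zero, Ne, ZMod.val_eq_zero, sub_eq_zero, σ.injective.eq_iff]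
      simp
    rw [h, mul_one] at hsum
    have ha := (Finset.sum_eq_sum_iff_of_le hpos).1 (hcard.trans hsum.symm) a (mem_univ a)
    rw [← sub_eq_iff_eq_add', ← ZMod.natCast_zmod_val (σ (a + 1) - σ a), ← ha, Nat.cast_one]
  · intro h
    simp only [h, add_sub_cancel_left, ZMod.val_one, hcard] at hsum
    exact (Nat.mul_eq_left (NeZero.ne n)).1 hsum.symm

theorem eq_addRight_of_map_add_one (n : ℕ) [NeZero n] (σ : Equiv.Perm (ZMod n))
    (h : ∀ a, σ (a + 1) = σ a + 1) : σ = Equiv.addRight (σ 0) := by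
  have hnat (k : ℕ) : σ k = k + σ 0 := by
    induction k with
    | zero => simp
    | succ k ih => rw [Nat.cast_succ, h, ih]; ring
  refine Equiv.ext fun a => ?_
  simpa using hnat a.val

theorem isUnit_of_isCycle_addRight (n : ℕ) [NeZero n] (c : ZMod n)
    (hc : (Equiv.addRight c).IsCycle) (hs : (Equiv.addRight c).support.card = n) :
    IsUnit c := by
  have hsupp : (Equiv.addRight c).support = univ :=
    Finset.eq_univ_of_card _ (by rw [hs, ZMod.card])
  have hmove (a : ZMod n) : Equiv.addRight c a ≠ a :=
    Equiv.Perm.mem_support.1 (hsupp ▸ mem_univ a)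
  obtain ⟨k, hk⟩ := hc.sameCycle (hmove 0) (hmove 1)
  refine IsUnit.of_mul_eq_one (k : ZMod n) ?_
  simpa [mul_comm] using hk

/-- an n-cycle σ has `des̄(σ) = 1` iff σ = λ_r for some r coprime to n. -/
theorem desbar_eq_one_iff (n : ℕ) [NeZero n] (hn : 2 ≤ n) (σ : Equiv.Perm (ZMod n))
    (hc : σ.IsCycle) (hs : σ.support.card = n) :
    desbar n σ = 1 ↔
      ∃ r : ℕ, 1 ≤ r ∧ r ≤ n ∧ Nat.gcd r n = 1 ∧ σ = Equiv.addRight ((r : ZMod n)) := by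
  rw [desbar_eq_one_iff_map_add_one n hn]
  constructor
  · intro h
    have hσ := eq_addRight_of_map_add_one n σ h
    rw [hσ] at hc hs
    refine ⟨zrep n (σ 0), one_le_zrep n _, zrep_le n _, ?_, by rw [zrep_cast]; exact hσ⟩
    rw [← Nat.coprime_iff_gcd_eq_one, ← ZMod.isUnit_iff_coprime, zrep_cast]
    exact isUnit_of_isCycle_addRight n _ hc hs
  · rintro ⟨r, -, -, -, rfl⟩ a
    simp only [Equiv.coe_addRight]
    ring
end
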